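/- Let 𝔞 be a finite-dimensional pre-Lie algebra viewed as a manifold, and define the (1,1) tensor N on 𝔞 by N(a^↑_x) = −(a▷x)^↑_x at the point x (i.e., N(a^↑) = X_{L(a)} where L(a)y = a▷y). Then N has vanishing Nijenhuis torsion. -/

import Mathlib

namespace Derivation

variable {k R : Type*} [CommRing k] [CommRing R] [Algebra k R]

theorem lie_smul_eq (X Y : Derivation k R R) (f : R) :
    ⁅X, f • Y⁆ = X f • Y + f • ⁅X, Y⁆ := by
  ext g
  simp only [commutator_apply, smul_apply, add_apply, smul_eq_mul, leibniz]
  ring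

/-- The Nijenhuis torsion of an `R`-linear endomorphism of the derivations of `R`. -/
def nijenhuisTorsion (N : Derivation k R R →ₗ[R] Derivation k R R) (X Y : Derivation k R R) :
    Derivation k R R :=
  ⁅N X, N Y⁆ + N (N ⁅X, Y⁆) - N ⁅N X, Y⁆ - N ⁅X, N Y⁆

variable (N : Derivation k R R →ₗ[R] Derivation k R R)

theorem nijenhuisTorsion_swap (X Y : Derivation k R R) :
    nijenhuisTorsion N X Y = -nijenhuisTorsion N Y X := by
  simp only [nijenhuisTorsion]
  rw [← lie_skew (N X) (N Y), ← lie_skew X Y, ← lie_skew (N X) Y, ← lie_skew X (N Y)]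
  simp only [map_neg]
  abel

theorem nijenhuisTorsion_add_right (X Y Z : Derivation k R R) :
    nijenhuisTorsion N X (Y + Z) = nijenhuisTorsion N X Y + nijenhuisTorsion N X Z := by
  simp only [nijenhuisTorsion, map_add, lie_add]
  abel

theorem nijenhuisTorsion_smul_right (f : R) (X Y : Derivation k R R) :
    nijenhuisTorsion N X (f • Y) = f • nijenhuisTorsion N X Y := by
  simp only [nijenhuisTorsion, _root_.map_smul, lie_smul_eq, map_add, smul_add, smul_sub]
  abel

/-- The Nijenhuis torsion with its first argument fixed, as an `R`-linear map. -/
def nijenhuisTorsionRight (X : Derivation k R R) : Derivation k R R →ₗ[R] Derivation k R R where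
  toFun := nijenhuisTorsion N X
  map_add' := nijenhuisTorsion_add_right N X
  map_smul' f := nijenhuisTorsion_smul_right N f X

/-- By tensoriality, the Nijenhuis torsion vanishes if it does so on a spanning set. -/
theorem nijenhuisTorsion_eq_zero_of_span_eq_top {s : Set (Derivation k R R)}
    (hs : Submodule.span R s = ⊤) (h : ∀ X ∈ s, ∀ Y ∈ s, nijenhuisTorsion N X Y = 0)
    (X Y : Derivation k R R) : nijenhuisTorsion N X Y = 0 := by
  have right : ∀ X, (∀ Y ∈ s, nijenhuisTorsion N X Y = 0) → ∀ Y, nijenhuisTorsion N X Y = 0 :=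
    fun X hX => LinearMap.congr_fun
      (LinearMap.ext_on hs (f := nijenhuisTorsionRight N X) (g := 0) hX)
  refine right X (fun Z hZ => ?_) Y
  rw [nijenhuisTorsion_swap, right Z (h Z hZ) X, neg_zero]

end Derivation


/- The finite-dimensional pre-Lie algebra `𝔞` is viewed as a manifold, with
function algebra `R` and vector fields `Derivation ℝ R R`; `up a` is the
constant vector field `a^↑`, `lin φ` the linear vector field `X_φ` with
`[X_φ, a^↑] = φ(a)^↑`, `[X_φ, X_ψ] = X_{[φ,ψ]}`, constant vector fields
commute, and every vector field is a `C∞`-combination of constant ones. -/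

/-- The linear `(1,1)` tensor `N(a^↑) = X_{L(a)}` (`L(a)x = a▷x`) on a
pre-Lie algebra has vanishing Nijenhuis torsion. -/
theorem preLie_linear_tensor_nijenhuis
    {𝔞 : Type*} [AddCommGroup 𝔞] [Module ℝ 𝔞] [FiniteDimensional ℝ 𝔞]
    (mul : 𝔞 →ₗ[ℝ] 𝔞 →ₗ[ℝ] 𝔞)
    (hpre : ∀ a b c : 𝔞,
      mul (mul a b) c - mul a (mul b c) = mul (mul b a) c - mul b (mul a c))
    {R : Type*} [CommRing R] [Algebra ℝ R]
    (up : 𝔞 →ₗ[ℝ] Derivation ℝ R R)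
    (lin : (𝔞 →ₗ[ℝ] 𝔞) → Derivation ℝ R R)
    (hconst : ∀ a b : 𝔞, ⁅up a, up b⁆ = 0)
    (hlin : ∀ (φ : 𝔞 →ₗ[ℝ] 𝔞) (a : 𝔞), ⁅lin φ, up a⁆ = up (φ a))
    (hlin2 : ∀ φ ψ : 𝔞 →ₗ[ℝ] 𝔞, ⁅lin φ, lin ψ⁆ = lin (φ ∘ₗ ψ - ψ ∘ₗ φ))
    (hspan : ∀ X : Derivation ℝ R R,
      ∃ (n : ℕ) (f : Fin n → R) (v : Fin n → 𝔞), X = ∑ i, f i • up (v i))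
    (N : Derivation ℝ R R →ₗ[R] Derivation ℝ R R)
    (hN : ∀ a : 𝔞, N (up a) = lin (mul a)) :
    ∀ X Y : Derivation ℝ R R,
      ⁅N X, N Y⁆ + N (N ⁅X, Y⁆) - N ⁅N X, Y⁆ - N ⁅X, N Y⁆ = 0 := by
  refine Derivation.nijenhuisTorsion_eq_zero_of_span_eq_top N (s := Set.range up) ?_ ?_
  · refine eq_top_iff.2 fun X _ => ?_
    obtain ⟨n, f, v, rfl⟩ := hspan X
    exact Submodule.sum_mem _ fun i _ =>
      Submodule.smul_mem _ _ (Submodule.subset_span (Set.mem_range_self _))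
  · rintro _ ⟨a, rfl⟩ _ ⟨b, rfl⟩
    have hL : mul a ∘ₗ mul b - mul b ∘ₗ mul a = mul (mul a b - mul b a) := by
      ext c
      have := hpre a b c
      simp only [LinearMap.sub_apply, LinearMap.comp_apply, map_sub]
      linear_combination (norm := module) -this
    rw [Derivation.nijenhuisTorsion, hN, hN, hconst, hlin, ← lie_skew (up a), hlin, hlin2, hL,
      ← hN]
    simp only [map_sub, map_neg, map_zero]
    abel
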